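/- Let B₁ := {z ∈ ℝ³ : ‖z‖₁ ≤ 1} and let m ≥ 0. Then the supremum, over all unit vectors n̂ ∈ ℝ³ (‖n̂‖₂ = 1), of the Euclidean distance dist(m·n̂, B₁) equals max(0, m − 1/√3), and when m > 1/√3 this supremum is attained at n̂ = (1/√3)(1, 1, 1). -/

import Mathlib

open Real

lemma l1_le_aux (x : EuclideanSpace ℝ (Fin 3)) (r : ℝ) (hr : 0 ≤ r)
    (hx : ‖x‖ = r) (h : 3 * r ^ 2 ≤ 1) : ∑ i, |x i| ≤ 1 := by
  have h1 := EuclideanSpace.real_norm_sq_eq x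
  rw [hx, Fin.sum_univ_three, ← sq_abs (x 0), ← sq_abs (x 1), ← sq_abs (x 2)] at h1
  rw [Fin.sum_univ_three]
  refine abs_le_of_sq_le_sq' ?_ zero_le_one |>.2
  nlinarith [sq_nonneg (|x 0| - |x 1|), sq_nonneg (|x 0| - |x 2|), sq_nonneg (|x 1| - |x 2|)]

/-- Optimal Hamiltonian direction: for the unit ℓ1 ball `B₁ ⊆ ℝ³` and `m ≥ 0`, the
supremum over Euclidean unit vectors `n̂` of `dist(m n̂, B₁)` equals `max(0, m − 1/√3)`,
and when `m > 1/√3` it is attained at `n̂ = (1/√3)(1,1,1)`. -/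
theorem optimal_hamiltonian (m : ℝ) (hm : 0 ≤ m)
    (B1 : Set (EuclideanSpace ℝ (Fin 3)))
    (hB1 : B1 = {z : EuclideanSpace ℝ (Fin 3) | ∑ i, |z i| ≤ 1}) :
    sSup {d : ℝ | ∃ nhat : EuclideanSpace ℝ (Fin 3), ‖nhat‖ = 1 ∧
        d = Metric.infDist (m • nhat) B1} = max 0 (m - 1 / Real.sqrt 3) ∧
      (1 / Real.sqrt 3 < m →
        ∀ nstar : EuclideanSpace ℝ (Fin 3), (∀ i, nstar i = 1 / Real.sqrt 3) →
          ‖nstar‖ = 1 ∧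
            Metric.infDist (m • nstar) B1 = max 0 (m - 1 / Real.sqrt 3)) := by
  have hs : 0 < Real.sqrt 3 := Real.sqrt_pos.mpr (by norm_num)
  have hsq : Real.sqrt 3 ^ 2 = 3 := Real.sq_sqrt (by norm_num)
  set c : ℝ := 1 / Real.sqrt 3 with hc
  have hc0 : 0 < c := by positivity
  have hc2 : 3 * c ^ 2 = 1 := by rw [hc, div_pow, hsq]; norm_num
  have up : ∀ n : EuclideanSpace ℝ (Fin 3), ‖n‖ = 1 →
      Metric.infDist (m • n) B1 ≤ max 0 (m - c) := by
    intro n hn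
    rcases le_total m c with h | h
    · have : m • n ∈ B1 := by
        rw [hB1]
        refine l1_le_aux _ m hm ?_ ?_
        · rw [norm_smul, hn, mul_one, Real.norm_of_nonneg hm]
        · nlinarith
      rw [Metric.infDist_zero_of_mem this]
      exact le_max_left _ _
    · have : c • n ∈ B1 := by
        rw [hB1]
        refine l1_le_aux _ c hc0.le ?_ hc2.le
        rw [norm_smul, hn, mul_one, Real.norm_of_nonneg hc0.le]
      refine (Metric.infDist_le_dist_of_mem this).trans ?_
      rw [dist_eq_norm, ← sub_smul, norm_smul, hn, mul_one,
        Real.norm_of_nonneg (sub_nonneg.mpr h)]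
      exact le_max_right _ _
  have star : ∀ n : EuclideanSpace ℝ (Fin 3), (∀ i, n i = c) →
      ‖n‖ = 1 ∧ Metric.infDist (m • n) B1 = max 0 (m - c) := by
    intro n hn
    have hn1 : ‖n‖ = 1 := by
      have h1 := EuclideanSpace.real_norm_sq_eq n
      rw [Fin.sum_univ_three, hn, hn, hn] at h1
      have := norm_nonneg n
      nlinarith
    refine ⟨hn1, le_antisymm (up n hn1) (max_le Metric.infDist_nonneg ?_)⟩
    have hne : B1.Nonempty := ⟨0, by rw [hB1]; simp⟩
    rw [Metric.le_infDist hne]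
    intro z hz
    rw [hB1] at hz
    have hz' : |z 0| + |z 1| + |z 2| ≤ 1 := by
      simpa [Fin.sum_univ_three] using hz
    have h1 := real_inner_le_norm (m • n - z) n
    rw [hn1, mul_one, ← dist_eq_norm] at h1
    refine le_trans ?_ h1
    have h2 : inner ℝ (m • n - z) n = m * (3 * c ^ 2) - c * (z 0 + z 1 + z 2) := by
      simp [PiLp.inner_apply, Fin.sum_univ_three, hn]
      ring
    rw [h2, hc2]
    nlinarith [le_abs_self (z 0), le_abs_self (z 1), le_abs_self (z 2)]
  refine ⟨IsGreatest.csSup_eq ⟨?_, ?_⟩, fun _ => star⟩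
  · have := star (WithLp.toLp 2 (fun _ => c)) (fun _ => rfl)
    exact ⟨_, this.1, this.2.symm⟩
  · rintro d ⟨n, hn, rfl⟩
    exact up n hn
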